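/- arXiv:2507.23316 — 10 statements merged into one kernel-verified Lean document; each statement's English description precedes it below -/
import Mathlib

section
/- For every lower semilinear diagonal δ ∈ 𝒟^LSL, Kendall's tau does not exceed Spearman's rho: τ(δ) ≤ ρ(δ). -/
open MeasureTheory Set

/-- A lower semilinear diagonal: nondecreasing, 2-Lipschitz on `[0,1]`, `δ 1 = 1`,
`t² ≤ δ t ≤ t` on `[0,1]`, `t ↦ δ t / t` nondecreasing on `(0,1]` and
`t ↦ δ t / t²` nonincreasing on `(0,1]`. -/
def IsLSL (δ : ℝ → ℝ) : Prop :=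
  MonotoneOn δ (Icc 0 1) ∧
  LipschitzOnWith 2 δ (Icc 0 1) ∧
  δ 1 = 1 ∧
  (∀ t ∈ Icc (0:ℝ) 1, t ^ 2 ≤ δ t ∧ δ t ≤ t) ∧
  MonotoneOn (fun t => δ t / t) (Ioc 0 1) ∧
  AntitoneOn (fun t => δ t / t ^ 2) (Ioc 0 1)

/-- Kendall's tau of the lower semilinear copula with diagonal `δ`. -/
noncomputable def tauLSL (δ : ℝ → ℝ) : ℝ := 4 * (∫ t in (0:ℝ)..1, (δ t) ^ 2 / t) - 1

/-- Spearman's rho of the lower semilinear copula with diagonal `δ`. -/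
noncomputable def rhoLSL (δ : ℝ → ℝ) : ℝ := 12 * (∫ t in (0:ℝ)..1, t * δ t) - 3

/-- Spearman's footrule of the lower semilinear copula with diagonal `δ`. -/
noncomputable def phiLSL (δ : ℝ → ℝ) : ℝ := 6 * (∫ t in (0:ℝ)..1, δ t) - 2

/-- Chatterjee's rank correlation of the lower semilinear copula with diagonal `δ`,
expressed through the a.e. derivative of `δ` (represented by `deriv δ`, which agrees
with the a.e. derivative almost everywhere since `δ` is Lipschitz on `[0,1]`). -/
noncomputable def xiLSL (δ : ℝ → ℝ) : ℝ :=
  tauLSL δ - 2 * ∫ t in (0:ℝ)..1,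
    (t * deriv δ t - δ t) * (2 * δ t - t * deriv δ t) / t

/-- The diagonal `u_a`: `u_a t = t²/a` for `t ≤ a`, `u_a t = t` otherwise (`u_0 t = t`). -/
noncomputable def uDiag (a : ℝ) (t : ℝ) : ℝ :=
  if a = 0 then t else if t ≤ a then t ^ 2 / a else t

/-- The diagonal `l_a`: `l_a t = a·t` for `t ≤ a`, `l_a t = t²` otherwise. -/
noncomputable def lDiag (a : ℝ) (t : ℝ) : ℝ := if t ≤ a then a * t else t ^ 2

/-- The integrand `δ t ^ 2 / t` of Kendall's tau is integrable. -/
theorem IsLSL.intervalIntegrable_sq_div {δ : ℝ → ℝ} (hδ : IsLSL δ) :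
    IntervalIntegrable (fun t => δ t ^ 2 / t) volume 0 1 := by
  obtain ⟨-, hlip, -, hbd, -, -⟩ := hδ
  rw [intervalIntegrable_iff_integrableOn_Ioc_of_le zero_le_one]
  have hc : ContinuousOn (fun t => δ t ^ 2 / t) (Ioc 0 1) :=
    ((hlip.continuousOn.mono Ioc_subset_Icc_self).pow 2).div continuousOn_id
      fun t ht => ht.1.ne'
  refine Integrable.of_bound (hc.aestronglyMeasurable measurableSet_Ioc) 1 ?_
  filter_upwards [ae_restrict_mem measurableSet_Ioc] with t ht
  obtain ⟨h1, h2⟩ := hbd t (Ioc_subset_Icc_self ht)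
  rw [Real.norm_of_nonneg (div_nonneg (sq_nonneg _) ht.1.le), div_le_one ht.1]
  nlinarith [ht.1, ht.2, sq_nonneg t]

/-- Since `δ t / t` is nondecreasing, `δ t ≤ t * δ' t` wherever `δ` is differentiable. -/
theorem IsLSL.le_mul_deriv {δ : ℝ → ℝ} (hδ : IsLSL δ) {t : ℝ} (ht : t ∈ Ioo (0 : ℝ) 1)
    (hd : DifferentiableAt ℝ δ t) : δ t ≤ t * deriv δ t := by
  obtain ⟨-, -, -, -, hmono, -⟩ := hδ
  have h1 : HasDerivAt (fun s => δ s / s) ((deriv δ t * t - δ t * 1) / t ^ 2) t :=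
    hd.hasDerivAt.div (hasDerivAt_id t) ht.1.ne'
  have h2 := (hmono.mono Ioo_subset_Ioc_self).derivWithin_nonneg (x := t)
  rw [derivWithin_of_isOpen isOpen_Ioo ht, h1.deriv,
    le_div_iff₀ (pow_pos ht.1 2)] at h2
  linarith

/-- The derivative of `t ↦ δ t * (2 * t ^ 2 - δ t)` is dominated by the difference of the
integrands of Spearman's rho and Kendall's tau. -/
theorem IsLSL.deriv_mul_two_mul_sq_sub_le {δ : ℝ → ℝ} (hδ : IsLSL δ) {t : ℝ}
    (ht : t ∈ Ioo (0 : ℝ) 1) (hd : DifferentiableAt ℝ δ t) :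
    deriv (δ * fun s => 2 * s ^ 2 - δ s) t ≤ 6 * (t * δ t) - 2 * (δ t ^ 2 / t) := by
  have hle := hδ.le_mul_deriv ht hd
  have hsq := (hδ.2.2.2.1 t (Ioo_subset_Icc_self ht)).1
  have h1 : HasDerivAt (fun s : ℝ => 2 * s ^ 2 - δ s) (2 * (2 * t) - deriv δ t) t := by
    simpa using ((hasDerivAt_pow 2 t).const_mul 2).fun_sub hd.hasDerivAt
  rw [(hd.hasDerivAt.mul h1).deriv, ← sub_nonneg]
  have key : 6 * (t * δ t) - 2 * (δ t ^ 2 / t) -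
      (deriv δ t * (2 * t ^ 2 - δ t) + δ t * (2 * (2 * t) - deriv δ t)) =
      2 * (δ t - t ^ 2) * (t * deriv δ t - δ t) / t := by
    have := ht.1.ne'
    field_simp
    ring
  rw [key]
  exact div_nonneg (mul_nonneg (by linarith) (by linarith)) ht.1.le

/-- For every lower semilinear diagonal, Kendall's tau does not exceed Spearman's rho. -/
theorem tau_le_rho (δ : ℝ → ℝ) (hδ : IsLSL δ) : tauLSL δ ≤ rhoLSL δ := by
  have hlip : LipschitzOnWith 2 δ (uIcc 0 1) := by
    simpa [uIcc_of_le] using hδ.2.1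
  have hac := hlip.absolutelyContinuousOnInterval
  have hacF : AbsolutelyContinuousOnInterval (δ * fun s => 2 * s ^ 2 - δ s) 0 1 := by
    refine hac.mul (AbsolutelyContinuousOnInterval.sub (f := fun s : ℝ => 2 * s ^ 2) ?_ hac)
    exact ContDiffOn.absolutelyContinuousOnInterval (by fun_prop)
  have hF := hacF.integral_deriv_eq_sub
  have h0 : δ 0 = 0 := by
    obtain ⟨h1, h2⟩ := hδ.2.2.2.1 0 (by simp)
    linarith
  have hiρ : IntervalIntegrable (fun t => t * δ t) volume 0 1 :=
    (continuousOn_id.mul hac.continuousOn).intervalIntegrable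
  have hiτ := hδ.intervalIntegrable_sq_div
  have hle : ∫ t in (0 : ℝ)..1, deriv (δ * fun s => 2 * s ^ 2 - δ s) t ≤
      ∫ t in (0 : ℝ)..1, (6 * (t * δ t) - 2 * (δ t ^ 2 / t)) := by
    refine intervalIntegral.integral_mono_ae_restrict zero_le_one hacF.intervalIntegrable_deriv
      ((hiρ.const_mul 6).sub (hiτ.const_mul 2)) ?_
    rw [Filter.EventuallyLE, ← restrict_Ioo_eq_restrict_Icc, ae_restrict_iff' measurableSet_Ioo]
    filter_upwards [hδ.2.1.ae_differentiableWithinAt_of_mem (μ := volume)] with t hd ht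
    exact hδ.deriv_mul_two_mul_sq_sub_le ht
      ((hd (Ioo_subset_Icc_self ht)).differentiableAt (Icc_mem_nhds ht.1 ht.2))
  rw [hF, intervalIntegral.integral_sub (hiρ.const_mul 6) (hiτ.const_mul 2),
    intervalIntegral.integral_const_mul, intervalIntegral.integral_const_mul] at hle
  simp only [Pi.mul_apply, h0, hδ.2.2.1] at hle
  unfold tauLSL rhoLSL
  linarith
end

section
/- For every lower semilinear diagonal δ ∈ 𝒟^LSL, Spearman's rho satisfies ρ(δ) ≤ 1 − (1 − τ(δ))^{3/2}; equivalently, (1 − τ(δ))³ ≤ (1 − ρ(δ))². -/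
open MeasureTheory Set

namespace IsLSL

variable {δ : ℝ → ℝ}

lemma intervalIntegrable_id_mul (hδ : IsLSL δ) :
    IntervalIntegrable (fun t => t * δ t) volume 0 1 := by
  refine ContinuousOn.intervalIntegrable ?_
  rw [uIcc_of_le zero_le_one]
  exact continuousOn_id.mul hδ.2.1.continuousOn

lemma intervalIntegrable_sq_div_s1 (hδ : IsLSL δ) :
    IntervalIntegrable (fun t => δ t ^ 2 / t) volume 0 1 := by
  have hmono : MonotoneOn (fun t => δ t / t) (uIcc 0 1) := by
    rw [uIcc_of_le zero_le_one]
    intro x hx y hy hxy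
    rcases hx.1.eq_or_lt with rfl | hx0
    · have := (hδ.2.2.2.1 y hy).1
      simpa using div_nonneg ((sq_nonneg y).trans this) hy.1
    · exact hδ.2.2.2.2.1 ⟨hx0, hx.2⟩ ⟨hx0.trans_le hxy, hy.2⟩ hxy
  have hcont : ContinuousOn δ (uIcc 0 1) := by
    rw [uIcc_of_le zero_le_one]
    exact hδ.2.1.continuousOn
  refine (hmono.intervalIntegrable.continuousOn_mul hcont).congr fun t _ => ?_
  ring

/-- On `[0, 1]` one has `t³ ≤ δ(t)² / t ≤ t`. -/
lemma sq_div_mem_Icc (hδ : IsLSL δ) {t : ℝ} (ht : t ∈ Icc (0 : ℝ) 1) :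
    δ t ^ 2 / t ∈ Icc (t ^ 3) t := by
  obtain ⟨h1, h2⟩ := hδ.2.2.2.1 t ht
  rcases ht.1.eq_or_lt with rfl | h0
  · simp
  · constructor
    · rw [le_div_iff₀ h0]
      nlinarith [sq_nonneg t]
    · rw [div_le_iff₀ h0]
      nlinarith [sq_nonneg t]

lemma tauLSL_mem_Icc (hδ : IsLSL δ) : tauLSL δ ∈ Icc (0 : ℝ) 1 := by
  have h1 : ∫ t in (0 : ℝ)..1, t ^ 3 ≤ ∫ t in (0 : ℝ)..1, δ t ^ 2 / t :=
    intervalIntegral.integral_mono_on zero_le_one (Continuous.intervalIntegrable (by fun_prop) _ _)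
      hδ.intervalIntegrable_sq_div_s1 fun t ht => (hδ.sq_div_mem_Icc ht).1
  have h2 : ∫ t in (0 : ℝ)..1, δ t ^ 2 / t ≤ ∫ t in (0 : ℝ)..1, t :=
    intervalIntegral.integral_mono_on zero_le_one hδ.intervalIntegrable_sq_div_s1
      intervalIntegral.intervalIntegrable_id fun t ht => (hδ.sq_div_mem_Icc ht).2
  rw [integral_pow] at h1
  rw [integral_id] at h2
  norm_num at h1 h2
  constructor <;> unfold tauLSL <;> linarith

/-- The tangent lines of `x ↦ x ^ (3 / 2)` at `x = a²` lie below `1 - ρ` as a function of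
`1 - τ`. -/
lemma tangent_le_one_sub_rhoLSL (hδ : IsLSL δ) {a : ℝ} (ha : a ∈ Icc (0 : ℝ) 1) :
    3 / 2 * a * (1 - tauLSL δ) - a ^ 3 / 2 ≤ 1 - rhoLSL δ := by
  have hq := hδ.intervalIntegrable_sq_div_s1
  have hm := hδ.intervalIntegrable_id_mul
  have hF : IntervalIntegrable (fun t => 6 * a * (δ t ^ 2 / t) - 12 * (t * δ t)) volume 0 1 :=
    (hq.const_mul _).sub (hm.const_mul _)
  have hF1 : IntervalIntegrable (fun t => 6 * a * (δ t ^ 2 / t) - 12 * (t * δ t)) volume 0 a :=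
    hF.mono_set (by
      rw [uIcc_of_le ha.1, uIcc_of_le zero_le_one]; exact Icc_subset_Icc_right ha.2)
  have hF2 : IntervalIntegrable (fun t => 6 * a * (δ t ^ 2 / t) - 12 * (t * δ t)) volume a 1 :=
    hF.mono_set (by
      rw [uIcc_of_le ha.2, uIcc_of_le zero_le_one]; exact Icc_subset_Icc_left ha.1)
  have h1 : ∫ t in (0 : ℝ)..a, -6 / a * t ^ 3 ≤
      ∫ t in (0 : ℝ)..a, (6 * a * (δ t ^ 2 / t) - 12 * (t * δ t)) := by
    refine intervalIntegral.integral_mono_on ha.1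
      (Continuous.intervalIntegrable (by fun_prop) _ _) hF1 fun t ht => ?_
    rcases ht.1.eq_or_lt with rfl | h0
    · simp
    · have ha0 : 0 < a := h0.trans_le ht.2
      have key : 6 * a * (δ t ^ 2 / t) - 12 * (t * δ t) - -6 / a * t ^ 3 =
          6 / (a * t) * (a * δ t - t ^ 2) ^ 2 := by
        field_simp
        ring
      have : 0 ≤ 6 / (a * t) * (a * δ t - t ^ 2) ^ 2 := by positivity
      linarith
  have h2 : ∫ t in a..1, (6 * a * t - 12 * t ^ 2) ≤
      ∫ t in a..1, (6 * a * (δ t ^ 2 / t) - 12 * (t * δ t)) := by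
    refine intervalIntegral.integral_mono_on ha.2
      (Continuous.intervalIntegrable (by fun_prop) _ _) hF2 fun t ht => ?_
    have ht0 : 0 ≤ t := ha.1.trans ht.1
    have hδt := (hδ.2.2.2.1 t ⟨ht0, ht.2⟩)
    rcases ht0.eq_or_lt with rfl | h0
    · simp
    · have key : 6 * a * (δ t ^ 2 / t) - 12 * (t * δ t) - (6 * a * t - 12 * t ^ 2) =
          6 / t * ((t - δ t) * (2 * t ^ 2 - a * (t + δ t))) := by
        field_simp
        ring
      have h3 : a * (t + δ t) ≤ t * (t + t) :=
        mul_le_mul ht.1 (by linarith [hδt.2]) (by nlinarith [hδt.1]) ht0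
      have : 0 ≤ 6 / t * ((t - δ t) * (2 * t ^ 2 - a * (t + δ t))) :=
        mul_nonneg (by positivity)
          (mul_nonneg (by linarith [hδt.2]) (by nlinarith))
      linarith
  have e1 : ∫ t in (0 : ℝ)..a, -6 / a * t ^ 3 = -3 / 2 * a ^ 3 := by
    rw [intervalIntegral.integral_const_mul, integral_pow]
    rcases eq_or_ne a 0 with rfl | h
    · simp
    · push_cast
      field_simp
      ring
  have e2 : ∫ t in a..1, (6 * a * t - 12 * t ^ 2) = 3 * a - 4 + a ^ 3 := by
    rw [intervalIntegral.integral_sub (Continuous.intervalIntegrable (by fun_prop) _ _)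
      (Continuous.intervalIntegrable (by fun_prop) _ _), intervalIntegral.integral_const_mul,
      intervalIntegral.integral_const_mul, integral_pow, integral_id]
    push_cast
    ring
  have e3 := intervalIntegral.integral_add_adjacent_intervals hF1 hF2
  rw [intervalIntegral.integral_sub (hq.const_mul _) (hm.const_mul _),
    intervalIntegral.integral_const_mul, intervalIntegral.integral_const_mul] at e3
  unfold tauLSL rhoLSL
  linarith

end IsLSL

/-- For every lower semilinear diagonal, `ρ(δ) ≤ 1 − (1 − τ(δ))^{3/2}`;
equivalently, `(1 − τ(δ))³ ≤ (1 − ρ(δ))²`. -/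
theorem rho_le_one_sub_rpow (δ : ℝ → ℝ) (hδ : IsLSL δ) :
    rhoLSL δ ≤ 1 - (1 - tauLSL δ) ^ ((3:ℝ)/2) ∧
    (1 - tauLSL δ) ^ 3 ≤ (1 - rhoLSL δ) ^ 2 := by
  obtain ⟨h0, h1⟩ := hδ.tauLSL_mem_Icc
  have hT : 0 ≤ 1 - tauLSL δ := by linarith
  have ha : √(1 - tauLSL δ) ∈ Icc (0 : ℝ) 1 :=
    ⟨Real.sqrt_nonneg _, Real.sqrt_le_one.2 (by linarith)⟩
  have hsq := Real.sq_sqrt hT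
  have hrpow : (1 - tauLSL δ) ^ ((3 : ℝ) / 2) = √(1 - tauLSL δ) ^ 3 := by
    rw [Real.rpow_div_two_eq_sqrt _ hT]
    exact_mod_cast Real.rpow_natCast _ 3
  have key := hδ.tangent_le_one_sub_rhoLSL ha
  rw [hrpow]
  generalize √(1 - tauLSL δ) = a at *
  rw [← hsq] at key ⊢
  have hle : a ^ 3 ≤ 1 - rhoLSL δ := by linarith
  refine ⟨by linarith, ?_⟩
  calc (a ^ 2) ^ 3 = (a ^ 3) ^ 2 := by ring
    _ ≤ (1 - rhoLSL δ) ^ 2 := pow_le_pow_left₀ (pow_nonneg ha.1 3) hle 2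
end

section
/- For every lower semilinear diagonal δ ∈ 𝒟^LSL, Kendall's tau does not exceed Spearman's footrule: τ(δ) ≤ φ(δ). -/
open MeasureTheory Set

/-- If at every point `x` of `[a, b)` the function `F` lies, to the right of `x`, below a function
touching it at `x` with derivative `f x` there, then the increment of `F` over `[a, b]` is at most
the integral of `f`. -/
theorem sub_le_integral_of_touching_above {F f : ℝ → ℝ} {a b : ℝ} (hab : a ≤ b)
    (hF : ContinuousOn F (Icc a b)) (hf : ContinuousOn f (Icc a b))
    (h : ∀ x ∈ Ico a b, ∃ P : ℝ → ℝ, HasDerivAt P (f x) x ∧ P x = F x ∧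
      ∀ z ∈ Ioc x b, F z ≤ P z) :
    F b - F a ≤ ∫ t in a..b, f t := by
  set g : ℝ → ℝ := IccExtend hab ((Icc a b).domRestrict f) with hg
  have hgc : Continuous g := hf.domRestrict.Icc_extend'
  have hgf : ∀ x ∈ Icc a b, g x = f x := fun x hx => IccExtend_of_mem hab _ hx
  have hint : ∫ t in a..b, f t = ∫ t in a..b, g t :=
    intervalIntegral.integral_congr fun x hx => (hgf x (by rwa [uIcc_of_le hab] at hx)).symm
  have hderiv : ∀ x, HasDerivAt (fun u => F a + ∫ t in a..u, g t) (g x) x := fun x =>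
    (hgc.integral_hasStrictDerivAt a x).hasDerivAt.const_add (F a)
  have key := image_le_of_liminf_slope_right_le_deriv_boundary (f := F) (a := a) (b := b)
    (B := fun u => F a + ∫ t in a..u, g t) (B' := g) hF (by simp)
    (fun x _ => (hderiv x).continuousAt.continuousWithinAt)
    (fun x _ => (hderiv x).hasDerivWithinAt) ?_ (right_mem_Icc.2 hab)
  · rw [hint]
    linarith
  · intro x hx r hr
    obtain ⟨P, hP, hPx, hle⟩ := h x hx
    rw [hgf x (Ico_subset_Icc_self hx)] at hr
    have hslope : ∀ᶠ z in nhdsWithin x (Ioi x), slope P x z < r :=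
      ((hasDerivAt_iff_tendsto_slope.1 hP).mono_left
        (nhdsWithin_mono _ fun z hz => ne_of_gt hz)).eventually_lt_const hr
    refine Filter.Eventually.frequently ?_
    filter_upwards [hslope, Ioc_mem_nhdsGT hx.2] with z hz hzm
    refine lt_of_le_of_lt ?_ hz
    rw [slope_def_field, slope_def_field, hPx]
    have := hle z hzm
    have := sub_pos.2 hzm.1
    gcongr

namespace IsLSL

variable {δ : ℝ → ℝ}

theorem continuousOn (hδ : IsLSL δ) : ContinuousOn δ (Icc 0 1) :=
  hδ.2.1.continuousOn

theorem sq_le (hδ : IsLSL δ) {t : ℝ} (ht : t ∈ Icc (0 : ℝ) 1) : t ^ 2 ≤ δ t :=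
  (hδ.2.2.2.1 t ht).1

theorem le_self (hδ : IsLSL δ) {t : ℝ} (ht : t ∈ Icc (0 : ℝ) 1) : δ t ≤ t :=
  (hδ.2.2.2.1 t ht).2

theorem nonneg (hδ : IsLSL δ) {t : ℝ} (ht : t ∈ Icc (0 : ℝ) 1) : 0 ≤ δ t :=
  (sq_nonneg t).trans (hδ.sq_le ht)

theorem map_zero (hδ : IsLSL δ) : δ 0 = 0 :=
  le_antisymm (hδ.le_self (by simp)) (hδ.nonneg (by simp))

theorem continuousOn_sq_div (hδ : IsLSL δ) :
    ContinuousOn (fun t => δ t ^ 2 / t) (Icc 0 1) := by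
  intro x hx
  rcases hx.1.eq_or_lt with rfl | hx0
  · have hlim : Filter.Tendsto (fun t => δ t ^ 2 / t) (nhdsWithin 0 (Icc 0 1)) (nhds 0) := by
      refine tendsto_of_tendsto_of_tendsto_of_le_of_le' tendsto_const_nhds
        (Filter.tendsto_id.mono_left nhdsWithin_le_nhds) ?_ ?_
      · filter_upwards [self_mem_nhdsWithin] with t ht
        exact div_nonneg (sq_nonneg _) ht.1
      · filter_upwards [self_mem_nhdsWithin] with t ht
        refine div_le_of_le_mul₀ ht.1 ht.1 ?_
        have := hδ.le_self ht
        have := hδ.nonneg ht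
        simp only [id]
        nlinarith
    simpa [ContinuousWithinAt] using hlim
  · exact ((hδ.continuousOn x hx).pow 2).div continuousWithinAt_id hx0.ne'

/-- The tangent-line majorant of `t ↦ t * δ t - δ t ^ 2 / 2` to the right of a point. -/
theorem mul_sub_sq_le (hδ : IsLSL δ) {x z : ℝ} (hx : 0 < x) (hxz : x < z) (hz : z ≤ 1) :
    z * δ z - δ z ^ 2 / 2 ≤ z ^ 2 * (δ x / x - (δ x / x) ^ 2 / 2
      + (1 - δ x / x) * (δ x / x) / x * (z - x)) := by
  have hz0 : 0 < z := hx.trans hxz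
  have hxm : x ∈ Icc (0 : ℝ) 1 := ⟨hx.le, hxz.le.trans hz⟩
  have hanti : δ z / z ^ 2 ≤ δ x / x ^ 2 :=
    hδ.2.2.2.2.2 ⟨hx, hxm.2⟩ ⟨hz0, hz⟩ hxz.le
  have hg1 : δ x / x ≤ 1 := (div_le_one hx).2 (hδ.le_self hxm)
  have hstep : δ z / z - δ x / x ≤ δ x / x / x * (z - x) := by
    have h := mul_le_mul_of_nonneg_right hanti hz0.le
    have e1 : δ z / z ^ 2 * z = δ z / z := by field_simp
    have e2 : δ x / x ^ 2 * z = δ x / x + δ x / x / x * (z - x) := by field_simp; ring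
    linarith
  have e : z * δ z - δ z ^ 2 / 2 = z ^ 2 * (δ z / z - (δ z / z) ^ 2 / 2) := by field_simp
  rw [e]
  refine mul_le_mul_of_nonneg_left ?_ (sq_nonneg z)
  have h := mul_le_mul_of_nonneg_left hstep (sub_nonneg.2 hg1)
  have e3 : (1 - δ x / x) * (δ x / x) / x * (z - x)
      = (1 - δ x / x) * (δ x / x / x * (z - x)) := by ring
  rw [e3]
  nlinarith [sq_nonneg (δ z / z - δ x / x)]

theorem half_le_integral (hδ : IsLSL δ) :
    1 / 2 ≤ ∫ t in (0 : ℝ)..1, (3 * δ t - 2 * (δ t ^ 2 / t)) := by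
  have hc := hδ.continuousOn
  have key := sub_le_integral_of_touching_above (F := fun t => t * δ t - δ t ^ 2 / 2)
    (f := fun t => 3 * δ t - 2 * (δ t ^ 2 / t)) zero_le_one
    ((continuousOn_id.mul hc).sub ((hc.pow 2).div_const 2))
    ((hc.const_mul 3).sub (hδ.continuousOn_sq_div.const_mul 2)) ?_
  · norm_num [hδ.2.2.1, hδ.map_zero] at key ⊢
    exact key
  · intro x hx
    rcases hx.1.eq_or_lt with rfl | hx0
    · refine ⟨fun z => z ^ 2 / 2, ?_, by simp [hδ.map_zero], fun z _ => ?_⟩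
      · simpa [hδ.map_zero] using ((hasDerivAt_id (0 : ℝ)).pow 2).div_const 2
      · nlinarith [sq_nonneg (z - δ z)]
    · refine ⟨fun z => z ^ 2 * (δ x / x - (δ x / x) ^ 2 / 2
        + (1 - δ x / x) * (δ x / x) / x * (z - x)), ?_, ?_,
        fun z hz => hδ.mul_sub_sq_le hx0 hz.1 hz.2⟩
      · have hd := (hasDerivAt_pow 2 x).mul ((((hasDerivAt_id x).sub_const x).const_mul
          ((1 - δ x / x) * (δ x / x) / x)).const_add (δ x / x - (δ x / x) ^ 2 / 2))
        refine hd.congr_deriv ?_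
        simp only [id]
        field_simp
        ring
      · field_simp
        ring

end IsLSL

/-- For every lower semilinear diagonal, Kendall's tau does not exceed Spearman's footrule. -/
theorem tau_le_phi (δ : ℝ → ℝ) (hδ : IsLSL δ) : tauLSL δ ≤ phiLSL δ := by
  have h01 : uIcc (0 : ℝ) 1 = Icc 0 1 := uIcc_of_le zero_le_one
  have h1 : IntervalIntegrable δ volume 0 1 :=
    ContinuousOn.intervalIntegrable (h01 ▸ hδ.continuousOn)
  have h2 : IntervalIntegrable (fun t => δ t ^ 2 / t) volume 0 1 :=
    ContinuousOn.intervalIntegrable (h01 ▸ hδ.continuousOn_sq_div)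
  have key := hδ.half_le_integral
  rw [intervalIntegral.integral_sub (h1.const_mul 3) (h2.const_mul 2),
    intervalIntegral.integral_const_mul, intervalIntegral.integral_const_mul] at key
  unfold tauLSL phiLSL
  linarith
end

section
/- For every lower semilinear diagonal δ ∈ 𝒟^LSL, Spearman's footrule satisfies φ(δ) ≤ (τ(δ))^{3/4}; equivalently, (φ(δ))⁴ ≤ (τ(δ))³. -/
open MeasureTheory Set

theorem IsLSL.monotoneOn_sq_div {δ : ℝ → ℝ} (hδ : IsLSL δ) :
    MonotoneOn (fun t => (δ t) ^ 2 / t) (Icc 0 1) := by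
  obtain ⟨hm, -, -, hb, hd, -⟩ := hδ
  intro x hx y hy hxy
  have nonneg : ∀ t ∈ Icc (0:ℝ) 1, 0 ≤ δ t := fun t ht => (sq_nonneg t).trans (hb t ht).1
  have hy0 := nonneg y hy
  rcases hx.1.eq_or_lt with h0 | h0
  · simp only [← h0, div_zero]
    exact div_nonneg (sq_nonneg _) hy.1
  · have h1 : δ x / x ≤ δ y / y := hd ⟨h0, hx.2⟩ ⟨h0.trans_le hxy, hy.2⟩ hxy
    have h2 := hm hx hy hxy
    have h3 : δ x * (δ x / x) ≤ δ y * (δ y / y) :=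
      mul_le_mul h2 h1 (div_nonneg (nonneg x hx) hx.1) hy0
    simpa only [sq, mul_div_assoc] using h3

/-- Tangent inequality for `tauLSL` at the diagonal `lDiag a`. -/
theorem IsLSL.tangent_le_tauLSL {δ : ℝ → ℝ} (hδ : IsLSL δ) {a : ℝ} (ha : a ∈ Icc (0:ℝ) 1) :
    4 * a * phiLSL δ / 3 - a ^ 4 / 3 ≤ tauLSL δ := by
  have hb := hδ.2.2.2.1
  have sub : ∀ {x y : ℝ}, x ∈ Icc (0:ℝ) 1 → y ∈ Icc (0:ℝ) 1 → uIcc x y ⊆ Icc 0 1 :=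
    fun hx hy => ordConnected_Icc.uIcc_subset hx hy
  have h0 : (0:ℝ) ∈ Icc (0:ℝ) 1 := by simp
  have h1 : (1:ℝ) ∈ Icc (0:ℝ) 1 := by simp
  have iδ : ∀ {x y : ℝ}, x ∈ Icc (0:ℝ) 1 → y ∈ Icc (0:ℝ) 1 → IntervalIntegrable δ volume x y :=
    fun hx hy => (hδ.1.mono (sub hx hy)).intervalIntegrable
  have iq : ∀ {x y : ℝ}, x ∈ Icc (0:ℝ) 1 → y ∈ Icc (0:ℝ) 1 →
      IntervalIntegrable (fun t => (δ t) ^ 2 / t) volume x y :=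
    fun hx hy => (hδ.monotoneOn_sq_div.mono (sub hx hy)).intervalIntegrable
  have ip : ∀ {p : ℝ → ℝ} {x y : ℝ}, Continuous p → IntervalIntegrable p volume x y :=
    fun hp => hp.intervalIntegrable _ _
  have left : ∫ t in (0:ℝ)..a, (2 * a * δ t - a ^ 2 * t) ≤ ∫ t in (0:ℝ)..a, (δ t) ^ 2 / t := by
    refine intervalIntegral.integral_mono_on_of_le_Ioo ha.1
      (((iδ h0 ha).const_mul _).sub (ip (by fun_prop))) (iq h0 ha) fun t ht => ?_
    rw [le_div_iff₀ ht.1]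
    nlinarith [sq_nonneg (δ t - a * t)]
  have right : ∫ t in a..1, (2 * a * δ t + (t ^ 3 - 2 * a * t ^ 2)) ≤
      ∫ t in a..1, (δ t) ^ 2 / t := by
    refine intervalIntegral.integral_mono_on_of_le_Ioo ha.2
      (((iδ ha h1).const_mul _).add (ip (by fun_prop))) (iq ha h1) fun t ht => ?_
    have ht0 : 0 < t := ha.1.trans_lt ht.1
    rw [le_div_iff₀ ht0]
    nlinarith [sq_nonneg (δ t - t * t), mul_nonneg (mul_nonneg ht0.le (sub_nonneg.2 ht.1.le))
      (sub_nonneg.2 (hb t ⟨ht0.le, ht.2.le⟩).1)]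
  rw [intervalIntegral.integral_sub ((iδ h0 ha).const_mul _) (ip (by fun_prop)),
    intervalIntegral.integral_const_mul, intervalIntegral.integral_const_mul, integral_id] at left
  rw [intervalIntegral.integral_add ((iδ ha h1).const_mul _) (ip (by fun_prop)),
    intervalIntegral.integral_sub (ip (by fun_prop)) (ip (by fun_prop)),
    intervalIntegral.integral_const_mul, intervalIntegral.integral_const_mul, integral_pow,
    integral_pow] at right
  norm_num at left right
  have sδ := intervalIntegral.integral_add_adjacent_intervals (iδ h0 ha) (iδ ha h1)
  have sq := intervalIntegral.integral_add_adjacent_intervals (iq h0 ha) (iq ha h1)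
  rw [tauLSL, phiLSL, ← sδ, ← sq]
  linarith

theorem IsLSL.phiLSL_mem_Icc {δ : ℝ → ℝ} (hδ : IsLSL δ) : phiLSL δ ∈ Icc (0:ℝ) 1 := by
  have hb := hδ.2.2.2.1
  have iδ : IntervalIntegrable δ volume 0 1 :=
    MonotoneOn.intervalIntegrable (by simpa [uIcc_of_le] using hδ.1)
  have lo : ∫ t in (0:ℝ)..1, t ^ 2 ≤ ∫ t in (0:ℝ)..1, δ t :=
    intervalIntegral.integral_mono_on zero_le_one
      ((continuous_pow 2).intervalIntegrable _ _) iδ fun t ht => (hb t ht).1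
  have hi : ∫ t in (0:ℝ)..1, δ t ≤ ∫ t in (0:ℝ)..1, t :=
    intervalIntegral.integral_mono_on zero_le_one
      iδ (continuous_id.intervalIntegrable _ _) fun t ht => (hb t ht).2
  rw [integral_pow] at lo
  rw [integral_id] at hi
  norm_num at lo hi
  constructor <;> rw [phiLSL] <;> linarith

/-- For every lower semilinear diagonal, `φ(δ) ≤ (τ(δ))^{3/4}`;
equivalently, `(φ(δ))⁴ ≤ (τ(δ))³`. -/
theorem phi_le_tau_rpow (δ : ℝ → ℝ) (hδ : IsLSL δ) :
    phiLSL δ ≤ (tauLSL δ) ^ ((3:ℝ)/4) ∧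
    (phiLSL δ) ^ 4 ≤ (tauLSL δ) ^ 3 := by
  obtain ⟨hφ0, hφ1⟩ := hδ.phiLSL_mem_Icc
  obtain ⟨a, ha, hφ⟩ : ∃ a ∈ Icc (0:ℝ) 1, phiLSL δ = a ^ 3 := by
    refine ⟨phiLSL δ ^ ((1:ℝ) / 3),
      ⟨Real.rpow_nonneg hφ0 _, Real.rpow_le_one hφ0 hφ1 (by norm_num)⟩, ?_⟩
    rw [← Real.rpow_natCast, ← Real.rpow_mul hφ0]
    norm_num
  have hτ : a ^ 4 ≤ tauLSL δ := by
    have := hδ.tangent_le_tauLSL ha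
    rw [hφ] at this
    linarith
  have ha4 : 0 ≤ a ^ 4 := pow_nonneg ha.1 4
  rw [hφ]
  constructor
  · calc a ^ 3 = (a ^ 4) ^ ((3:ℝ) / 4) := by
          rw [← Real.rpow_natCast a 4, ← Real.rpow_mul ha.1, ← Real.rpow_natCast a 3]
          norm_num
      _ ≤ _ := Real.rpow_le_rpow ha4 hτ (by norm_num)
  · calc (a ^ 3) ^ 4 = (a ^ 4) ^ 3 := by ring
      _ ≤ _ := pow_le_pow_left₀ ha4 hτ 3
end

section
/- For every lower semilinear diagonal δ ∈ 𝒟^LSL, ρ(δ) ≤ 1 − (1 − φ(δ))^{3/2}; equivalently, (1 − φ(δ))³ ≤ (1 − ρ(δ))². -/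
open MeasureTheory Set

/-- A diagonal in the class crosses the diagonal `t ↦ min t (t² / a)` at most once,
from above. -/
theorem IsLSL.exists_crossing {δ : ℝ → ℝ} (hδ : IsLSL δ) (a : ℝ) :
    ∃ c : ℝ, ∀ t ∈ Icc (0:ℝ) 1, 0 ≤ (t - c) * ((t - δ t) - max 0 (t - t ^ 2 / a)) := by
  obtain ⟨-, -, -, hb, -, hanti⟩ := hδ
  set S : Set ℝ := {t | t ∈ Icc (0:ℝ) 1 ∧ t ^ 2 / a ≤ δ t}
  have h0 : (0:ℝ) ∈ S := by
    refine ⟨⟨le_rfl, zero_le_one⟩, ?_⟩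
    simpa using (hb 0 ⟨le_rfl, zero_le_one⟩).1
  have hbdd : BddAbove S := ⟨1, fun t ht => ht.1.2⟩
  refine ⟨sSup S, fun t ht => ?_⟩
  rcases lt_trichotomy t (sSup S) with h | h | h
  · obtain ⟨s, hs, hts⟩ := exists_lt_of_lt_csSup ⟨0, h0⟩ h
    have key : t ^ 2 / a ≤ δ t := by
      rcases ht.1.eq_or_lt with h' | h'
      · rw [← h']; exact h0.2
      · have hs0 : 0 < s := h'.trans hts
        have h1 : δ s / s ^ 2 ≤ δ t / t ^ 2 := hanti ⟨h', ht.2⟩ ⟨hs0, hs.1.2⟩ hts.le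
        have h2 : 1 / a ≤ δ s / s ^ 2 := by
          rw [le_div_iff₀ (by positivity)]
          have := hs.2
          rwa [div_mul_eq_mul_div, one_mul]
        have h3 := h2.trans h1
        rw [le_div_iff₀ (by positivity)] at h3
        rwa [div_mul_eq_mul_div, one_mul] at h3
    apply mul_nonneg_of_nonpos_of_nonpos
    · linarith
    · linarith [le_max_right 0 (t - t ^ 2 / a)]
  · simp [h]
  · have hn : ¬ t ^ 2 / a ≤ δ t := fun hc => absurd (le_csSup hbdd ⟨ht, hc⟩) (not_le.2 h)
    apply mul_nonneg (by linarith)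
    have : max 0 (t - t ^ 2 / a) ≤ t - δ t :=
      max_le (by linarith [(hb t ht).2]) (by linarith)
    linarith

theorem integral_max_zero_sub_sq_div {a : ℝ} (ha : 0 < a) (ha1 : a ≤ 1) :
    ∫ t in (0:ℝ)..1, max 0 (t - t ^ 2 / a) = a ^ 2 / 6 := by
  have hc : Continuous fun t : ℝ => max 0 (t - t ^ 2 / a) := by fun_prop
  rw [← intervalIntegral.integral_add_adjacent_intervals (hc.intervalIntegrable 0 a)
    (hc.intervalIntegrable a 1)]
  have h1 : ∫ t in (0:ℝ)..a, max 0 (t - t ^ 2 / a) = ∫ t in (0:ℝ)..a, (t - t ^ 2 / a) := by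
    refine intervalIntegral.integral_congr fun t ht => ?_
    rw [uIcc_of_le ha.le] at ht
    refine max_eq_right (sub_nonneg.2 ?_)
    rw [div_le_iff₀ ha]
    nlinarith [ht.1, ht.2]
  have h2 : ∫ t in a..1, max 0 (t - t ^ 2 / a) = ∫ t in a..1, (0:ℝ) := by
    refine intervalIntegral.integral_congr fun t ht => ?_
    rw [uIcc_of_le ha1] at ht
    refine max_eq_left (sub_nonpos.2 ?_)
    rw [le_div_iff₀ ha]
    nlinarith [ht.1, ht.2]
  rw [h1, h2, intervalIntegral.integral_sub (Continuous.intervalIntegrable (by fun_prop) _ _)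
    (Continuous.intervalIntegrable (by fun_prop) _ _), intervalIntegral.integral_div,
    integral_id, integral_pow]
  simp
  field_simp
  ring

theorem integral_mul_max_zero_sub_sq_div {a : ℝ} (ha : 0 < a) (ha1 : a ≤ 1) :
    ∫ t in (0:ℝ)..1, t * max 0 (t - t ^ 2 / a) = a ^ 3 / 12 := by
  have hc : Continuous fun t : ℝ => t * max 0 (t - t ^ 2 / a) := by fun_prop
  rw [← intervalIntegral.integral_add_adjacent_intervals (hc.intervalIntegrable 0 a)
    (hc.intervalIntegrable a 1)]
  have h1 : ∫ t in (0:ℝ)..a, t * max 0 (t - t ^ 2 / a)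
      = ∫ t in (0:ℝ)..a, (t ^ 2 - t ^ 3 / a) := by
    refine intervalIntegral.integral_congr fun t ht => ?_
    rw [uIcc_of_le ha.le] at ht
    have : max 0 (t - t ^ 2 / a) = t - t ^ 2 / a := by
      refine max_eq_right (sub_nonneg.2 ?_)
      rw [div_le_iff₀ ha]
      nlinarith [ht.1, ht.2]
    simp only [this]
    ring
  have h2 : ∫ t in a..1, t * max 0 (t - t ^ 2 / a) = ∫ t in a..1, (0:ℝ) := by
    refine intervalIntegral.integral_congr fun t ht => ?_
    rw [uIcc_of_le ha1] at ht
    have : max 0 (t - t ^ 2 / a) = 0 := by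
      refine max_eq_left (sub_nonpos.2 ?_)
      rw [le_div_iff₀ ha]
      nlinarith [ht.1, ht.2]
    simp only [this, mul_zero]
  rw [h1, h2, intervalIntegral.integral_sub (Continuous.intervalIntegrable (by fun_prop) _ _)
    (Continuous.intervalIntegrable (by fun_prop) _ _), intervalIntegral.integral_div,
    integral_pow, integral_pow]
  simp
  field_simp
  ring

theorem IsLSL.intervalIntegrable_mul {δ : ℝ → ℝ} (hδ : IsLSL δ) {f : ℝ → ℝ}
    (hf : Continuous f) : IntervalIntegrable (fun t => f t * δ t) volume 0 1 := by
  apply ContinuousOn.intervalIntegrable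
  rw [uIcc_of_le zero_le_one]
  exact hf.continuousOn.mul hδ.2.1.continuousOn

theorem IsLSL.one_sub_phiLSL {δ : ℝ → ℝ} (hδ : IsLSL δ) :
    1 - phiLSL δ = 6 * ∫ t in (0:ℝ)..1, (t - δ t) := by
  have hi : IntervalIntegrable δ volume 0 1 := by
    simpa using hδ.intervalIntegrable_mul (f := fun _ => 1) continuous_const
  rw [intervalIntegral.integral_sub (continuous_id'.intervalIntegrable _ _) hi, integral_id,
    phiLSL]
  ring

theorem IsLSL.one_sub_rhoLSL {δ : ℝ → ℝ} (hδ : IsLSL δ) :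
    1 - rhoLSL δ = 12 * ∫ t in (0:ℝ)..1, t * (t - δ t) := by
  have hi := hδ.intervalIntegrable_mul (f := fun t => t) continuous_id'
  have h : ∀ t : ℝ, t * (t - δ t) = t ^ 2 - t * δ t := fun t => by ring
  simp_rw [h]
  rw [intervalIntegral.integral_sub (Continuous.intervalIntegrable (by fun_prop) _ _) hi,
    integral_pow, rhoLSL]
  norm_num
  ring

theorem IsLSL.rhoLSL_le_one {δ : ℝ → ℝ} (hδ : IsLSL δ) : rhoLSL δ ≤ 1 := by
  have h : 0 ≤ ∫ t in (0:ℝ)..1, t * (t - δ t) :=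
    intervalIntegral.integral_nonneg zero_le_one fun t ht =>
      mul_nonneg ht.1 (sub_nonneg.2 (hδ.2.2.2.1 t ht).2)
  linarith [hδ.one_sub_rhoLSL]

theorem IsLSL.pow_three_le_one_sub_rhoLSL {δ : ℝ → ℝ} (hδ : IsLSL δ) {a : ℝ} (ha : 0 ≤ a)
    (haφ : a ^ 2 = 1 - phiLSL δ) : a ^ 3 ≤ 1 - rhoLSL δ := by
  rcases ha.eq_or_lt with rfl | ha
  · linarith [hδ.rhoLSL_le_one]
  have ha1 : a ≤ 1 := by nlinarith [hδ.phiLSL_mem_Icc.1]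
  obtain ⟨c, hc⟩ := hδ.exists_crossing a
  have hnn := intervalIntegral.integral_nonneg (μ := volume) zero_le_one hc
  have hg : IntervalIntegrable (fun t => t - δ t) volume 0 1 := by
    refine (Continuous.intervalIntegrable continuous_id' _ _).sub ?_
    simpa using hδ.intervalIntegrable_mul (f := fun _ => 1) continuous_const
  have htg : IntervalIntegrable (fun t => t * (t - δ t)) volume 0 1 :=
    hg.continuousOn_mul continuousOn_id
  have hk : IntervalIntegrable (fun t => max 0 (t - t ^ 2 / a)) volume 0 1 :=
    Continuous.intervalIntegrable (by fun_prop) _ _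
  have htk : IntervalIntegrable (fun t => t * max 0 (t - t ^ 2 / a)) volume 0 1 :=
    Continuous.intervalIntegrable (by fun_prop) _ _
  have hsplit : ∀ t : ℝ, (t - c) * ((t - δ t) - max 0 (t - t ^ 2 / a))
      = (t * (t - δ t) - t * max 0 (t - t ^ 2 / a))
        - c * ((t - δ t) - max 0 (t - t ^ 2 / a)) := fun t => by ring
  simp_rw [hsplit] at hnn
  rw [intervalIntegral.integral_sub (htg.sub htk) ((hg.sub hk).const_mul c),
    intervalIntegral.integral_sub htg htk, intervalIntegral.integral_const_mul,
    intervalIntegral.integral_sub hg hk, integral_max_zero_sub_sq_div ha ha1,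
    integral_mul_max_zero_sub_sq_div ha ha1] at hnn
  have hG : (∫ t in (0:ℝ)..1, (t - δ t)) - a ^ 2 / 6 = 0 := by
    linarith [hδ.one_sub_phiLSL]
  rw [hG] at hnn
  linarith [hδ.one_sub_rhoLSL]

/-- For every lower semilinear diagonal, `ρ(δ) ≤ 1 − (1 − φ(δ))^{3/2}`;
equivalently, `(1 − φ(δ))³ ≤ (1 − ρ(δ))²`. -/
theorem rho_le_one_sub_phi_rpow (δ : ℝ → ℝ) (hδ : IsLSL δ) :
    rhoLSL δ ≤ 1 - (1 - phiLSL δ) ^ ((3:ℝ)/2) ∧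
    (1 - phiLSL δ) ^ 3 ≤ (1 - rhoLSL δ) ^ 2 := by
  have hφ : 0 ≤ 1 - phiLSL δ := sub_nonneg.2 hδ.phiLSL_mem_Icc.2
  have hsq := Real.sq_sqrt hφ
  have ha := Real.sqrt_nonneg (1 - phiLSL δ)
  have key := hδ.pow_three_le_one_sub_rhoLSL ha hsq
  constructor
  · have h : (1 - phiLSL δ) ^ ((3:ℝ) / 2) = √(1 - phiLSL δ) ^ 3 := by
      rw [Real.sqrt_eq_rpow, ← Real.rpow_natCast, ← Real.rpow_mul hφ]
      norm_num
    linarith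
  · calc (1 - phiLSL δ) ^ 3 = (√(1 - phiLSL δ) ^ 3) ^ 2 := by
          rw [← pow_mul, mul_comm, pow_mul, hsq]
      _ ≤ (1 - rhoLSL δ) ^ 2 := pow_le_pow_left₀ (by positivity) key 2
end

section
/- A lower semilinear diagonal δ ∈ 𝒟^LSL equals u_a for some a ∈ [0,1] if and only if, for Lebesgue-almost every t ∈ [0,1], either δ(t) = t or t·δ′(t) = 2·δ(t), where δ′ denotes the almost-everywhere derivative of δ. -/
open MeasureTheory Set

theorem uDiag_eq_self_or_mul_deriv_eq {a t : ℝ} {δ : ℝ → ℝ} (ha : a ∈ Icc (0:ℝ) 1)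
    (h : ∀ t ∈ Icc (0:ℝ) 1, δ t = uDiag a t) (ht : t ∈ Icc (0:ℝ) 1) :
    δ t = t ∨ t * deriv δ t = 2 * δ t := by
  by_cases hat : a ≤ t
  · left
    rw [h t ht, uDiag]
    split_ifs with h0 hta
    · rfl
    · rw [← le_antisymm hat hta]
      field_simp
    · rfl
  push Not at hat
  have ha0 : a ≠ 0 := (ht.1.trans_lt hat).ne'
  have hsq : ∀ s ∈ Icc (0:ℝ) a, δ s = s ^ 2 / a := fun s hs => by
    rw [h s ⟨hs.1, hs.2.trans ha.2⟩, uDiag, if_neg ha0, if_pos hs.2]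
  rcases ht.1.eq_or_lt with rfl | ht0
  · left
    simp [hsq 0 ⟨le_rfl, hat.le⟩]
  right
  have hev : δ =ᶠ[nhds t] fun s => s ^ 2 / a := by
    filter_upwards [Ioo_mem_nhds ht0 hat] with s hs using hsq s (Ioo_subset_Icc_self hs)
  have hd : HasDerivAt (fun s : ℝ => s ^ 2 / a) (2 * t / a) t := by
    simpa using (hasDerivAt_pow 2 t).div_const a
  rw [hev.deriv_eq, hd.deriv, hsq t ⟨ht0.le, hat.le⟩]
  ring

/-- A Lipschitz function solving `x * f' x = 2 * f x` almost everywhere on `[s, a]` is a multiple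
of the square there. -/
theorem div_sq_eq_of_ae_mul_deriv_eq {f : ℝ → ℝ} {K : NNReal} {s a : ℝ} (hs : 0 < s) (hsa : s ≤ a)
    (hf : LipschitzOnWith K f (Icc s a)) (hpos : ∀ x ∈ Icc s a, 0 < f x)
    (h : ∀ᵐ x, x ∈ Icc s a → x * deriv f x = 2 * f x) :
    f s / s ^ 2 = f a / a ^ 2 := by
  have hf_ac : AbsolutelyContinuousOnInterval f s a :=
    (uIcc_of_le hsa ▸ hf).absolutelyContinuousOnInterval
  have hinv : AbsolutelyContinuousOnInterval (fun x : ℝ => (x ^ 2)⁻¹) s a := by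
    refine ContDiffOn.absolutelyContinuousOnInterval ?_
    rw [uIcc_of_le hsa]
    exact (contDiffOn_id.pow 2).inv fun x hx => pow_ne_zero 2 (hs.trans_le hx.1).ne'
  have hconst := (hf_ac.mul hinv).const_of_ae_hasDerivAt_zero ?_
  · obtain ⟨C, hC⟩ := hconst
    have h1 := hC s left_mem_uIcc
    have h2 := hC a right_mem_uIcc
    simpa [div_eq_mul_inv] using h1.trans h2.symm
  · filter_upwards [h] with x hx hxm
    rw [uIcc_of_le hsa] at hxm
    have hx0 : x ≠ 0 := (hs.trans_le hxm.1).ne'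
    have hxd := hx hxm
    have hdiff : DifferentiableAt ℝ f x := by
      refine differentiableAt_of_deriv_ne_zero fun h0 => ?_
      have := hpos x hxm
      rw [h0] at hxd
      linarith
    convert! hdiff.hasDerivAt.mul ((hasDerivAt_pow 2 x).inv (pow_ne_zero 2 hx0)) using 1
    rw [show deriv f x = 2 * f x / x by field_simp; linarith]
    simp only [Pi.inv_apply]
    norm_num
    field_simp
    ring

/-- A lower semilinear diagonal equals `u_a` for some `a ∈ [0,1]` iff, for a.e. `t ∈ [0,1]`,
either `δ t = t` or `t · δ′(t) = 2 · δ t`. -/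
theorem eq_uDiag_iff (δ : ℝ → ℝ) (hδ : IsLSL δ) :
    (∃ a ∈ Icc (0:ℝ) 1, ∀ t ∈ Icc (0:ℝ) 1, δ t = uDiag a t) ↔
    (∀ᵐ t ∂(volume.restrict (Icc (0:ℝ) 1)),
      δ t = t ∨ t * deriv δ t = 2 * δ t) := by
  rw [ae_restrict_iff' measurableSet_Icc]
  refine ⟨fun ⟨a, ha, h⟩ => .of_forall fun t ht => uDiag_eq_self_or_mul_deriv_eq ha h ht,
    fun h => ?_⟩
  obtain ⟨-, hlip, h1, hbd, hmono, -⟩ := hδ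
  set S : Set ℝ := {t ∈ Ioc (0:ℝ) 1 | δ t = t}
  have h1S : (1:ℝ) ∈ S := ⟨by simp, h1⟩
  have hbelow : BddBelow S := ⟨0, fun t ht => ht.1.1.le⟩
  have hclosed : IsClosed {t ∈ Icc (0:ℝ) 1 | δ t = t} :=
    isClosed_Icc.isClosed_eq hlip.continuousOn continuousOn_id
  obtain ⟨ha, hδa⟩ : sInf S ∈ {t ∈ Icc (0:ℝ) 1 | δ t = t} :=
    hclosed.closure_subset_iff.2 (fun t (ht : t ∈ S) => ⟨Ioc_subset_Icc_self ht.1, ht.2⟩)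
      (csInf_mem_closure ⟨1, h1S⟩ hbelow)
  set a := sInf S
  have habove : ∀ t ∈ Icc (0:ℝ) 1, a < t → δ t = t := fun t ht hat => by
    obtain ⟨s, hs, hst⟩ := exists_lt_of_csInf_lt ⟨1, h1S⟩ hat
    have ht0 : 0 < t := hs.1.1.trans hst
    have hle := hmono hs.1 ⟨ht0, ht.2⟩ hst.le
    simp only [hs.2, div_self hs.1.1.ne', one_le_div ht0] at hle
    exact le_antisymm (hbd t ht).2 hle
  have hδ0 : δ 0 = 0 := by
    have := hbd 0 (by simp)
    linarith [this.1, this.2]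
  refine ⟨a, ha, fun t ht => ?_⟩
  rcases ht.1.eq_or_lt with rfl | ht0
  · simp [hδ0, uDiag]
  rw [uDiag]
  split_ifs with ha0 hta
  · exact habove t ht (ha0 ▸ ht0)
  · have hsub : Icc t a ⊆ Icc 0 1 := Icc_subset_Icc ht.1 ha.2
    have hq := div_sq_eq_of_ae_mul_deriv_eq ht0 hta (hlip.mono hsub)
      (fun x hx => (pow_pos (ht0.trans_le hx.1) 2).trans_le (hbd x (hsub hx)).1) ?_
    · rw [hδa] at hq
      field_simp at hq ⊢
      linarith
    · filter_upwards [h, Measure.ae_ne volume a] with x hx hxa hxm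
      refine (hx (hsub hxm)).resolve_left fun hxx => ?_
      exact hxa (le_antisymm hxm.2 (csInf_le hbelow ⟨⟨ht0.trans_le hxm.1, (hsub hxm).2⟩, hxx⟩))
  · exact habove t ht (not_le.1 hta)
end

section
/- A lower semilinear diagonal δ ∈ 𝒟^LSL equals l_a for some a ∈ [0,1] if and only if, for Lebesgue-almost every t ∈ [0,1], either δ(t) = t² or t·δ′(t) = δ(t), where δ′ denotes the almost-everywhere derivative of δ. -/
open MeasureTheory Set

/-- An absolutely continuous solution of `z * deriv f z = f z` on an interval of positive reals is
linear. -/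
theorem AbsolutelyContinuousOnInterval.div_eq_div_of_ae_mul_deriv_eq {f : ℝ → ℝ} {x y : ℝ}
    (hx : 0 < x) (hxy : x ≤ y) (hf : AbsolutelyContinuousOnInterval f x y)
    (h : ∀ᵐ z, z ∈ Ioo x y → z * deriv f z = f z) : f x / x = f y / y := by
  have hinv : AbsolutelyContinuousOnInterval (fun z : ℝ => z⁻¹) x y := by
    refine ContDiffOn.absolutelyContinuousOnInterval (contDiffOn_id.inv fun z hz => ?_)
    rw [uIcc_of_le hxy] at hz
    exact (hx.trans_le hz.1).ne'
  obtain ⟨C, hC⟩ := (hf.fun_mul hinv).const_of_ae_hasDerivAt_zero (by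
    filter_upwards [h, hf.ae_differentiableAt, Measure.ae_ne volume x, Measure.ae_ne volume y]
      with z hz hd hzx hzy hmem
    have hdz := (hd hmem).hasDerivAt
    rw [uIcc_of_le hxy] at hmem
    have hz0 : z ≠ 0 := (hx.trans_le hmem.1).ne'
    have hode := hz ⟨lt_of_le_of_ne hmem.1 hzx.symm, lt_of_le_of_ne hmem.2 hzy⟩
    refine (hdz.fun_mul (hasDerivAt_inv hz0)).congr_deriv ?_
    rw [← hode]
    field_simp
    ring)
  simp only [div_eq_mul_inv]
  rw [hC x left_mem_uIcc, hC y right_mem_uIcc]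

/-- The points of `(0,1]` where a lower semilinear diagonal meets the parabola `t²` form an
up-closed set. -/
theorem IsLSL.eq_sq_of_le {δ : ℝ → ℝ} (hδ : IsLSL δ) {s t : ℝ} (hs : 0 < s) (hst : s ≤ t)
    (ht : t ≤ 1) (h : δ s = s ^ 2) : δ t = t ^ 2 := by
  obtain ⟨-, -, -, hbd, -, hanti⟩ := hδ
  have ht0 : 0 < t := hs.trans_le hst
  have hle : δ t / t ^ 2 ≤ δ s / s ^ 2 := hanti ⟨hs, hst.trans ht⟩ ⟨ht0, ht⟩ hst
  rw [h, div_self (by positivity), div_le_one (by positivity)] at hle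
  exact le_antisymm hle (hbd t ⟨ht0.le, ht⟩).1

/-- A lower semilinear diagonal equals `l_a` for some `a ∈ [0,1]` iff, for a.e. `t ∈ [0,1]`,
either `δ t = t²` or `t · δ′(t) = δ t`. -/
theorem eq_lDiag_iff (δ : ℝ → ℝ) (hδ : IsLSL δ) :
    (∃ a ∈ Icc (0:ℝ) 1, ∀ t ∈ Icc (0:ℝ) 1, δ t = lDiag a t) ↔
    (∀ᵐ t ∂(volume.restrict (Icc (0:ℝ) 1)),
      δ t = t ^ 2 ∨ t * deriv δ t = δ t) := by
  constructor
  · rintro ⟨a, -, h⟩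
    rw [ae_restrict_iff' measurableSet_Icc]
    filter_upwards [Measure.ae_ne volume a, Measure.ae_ne volume 0,
      Measure.ae_ne volume 1] with t hta ht0 ht1 ht
    rcases lt_or_gt_of_ne hta with hlt | hgt
    · right
      have heq : δ =ᶠ[nhds t] fun z => a * z := by
        filter_upwards [Ioo_mem_nhds (lt_of_le_of_ne ht.1 ht0.symm) (lt_of_le_of_ne ht.2 ht1),
          Iio_mem_nhds hlt] with z hz hza
        rw [h z ⟨hz.1.le, hz.2.le⟩, lDiag, if_pos (le_of_lt hza)]
      rw [heq.deriv_eq, heq.eq_of_nhds, deriv_const_mul_id]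
      ring
    · left
      rw [h t ht, lDiag, if_neg hgt.not_ge]
  · intro hae
    rw [ae_restrict_iff' measurableSet_Icc] at hae
    obtain ⟨-, hlip, hone, hbd, -, -⟩ := id hδ
    set S : Set ℝ := {t | t ∈ Ioc (0 : ℝ) 1 ∧ δ t = t ^ 2}
    have hne : S.Nonempty := ⟨1, ⟨one_pos, le_rfl⟩, by simpa using hone⟩
    have hbelow : BddBelow S := ⟨0, fun t ht => ht.1.1.le⟩
    have hclosed : IsClosed (Icc (0 : ℝ) 1 ∩ (fun t => δ t - t ^ 2) ⁻¹' {0}) :=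
      (hlip.continuousOn.sub (by fun_prop)).preimage_isClosed_of_isClosed isClosed_Icc
        isClosed_singleton
    have hsub : S ⊆ Icc (0 : ℝ) 1 ∩ (fun t => δ t - t ^ 2) ⁻¹' {0} := fun t ht =>
      ⟨Ioc_subset_Icc_self ht.1, sub_eq_zero.2 ht.2⟩
    obtain ⟨hmem, hsq⟩ := closure_minimal hsub hclosed (csInf_mem_closure hne hbelow)
    replace hsq : δ (sInf S) = sInf S ^ 2 := sub_eq_zero.1 hsq
    refine ⟨sInf S, hmem, fun t ht => ?_⟩
    unfold lDiag
    split_ifs with hta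
    · rcases eq_or_lt_of_le ht.1 with rfl | ht0
      · simpa using le_antisymm (hbd 0 ht).2 (by simpa using (hbd 0 ht).1)
      have hdiv := AbsolutelyContinuousOnInterval.div_eq_div_of_ae_mul_deriv_eq ht0 hta
        (hlip.mono (by
          rw [uIcc_of_le hta]
          exact Icc_subset_Icc ht.1 hmem.2)).absolutelyContinuousOnInterval (by
        filter_upwards [hae] with z hz hzmem
        have hz0 : 0 < z := ht0.trans hzmem.1
        have hz1 : z ≤ 1 := hzmem.2.le.trans hmem.2
        exact (hz ⟨hz0.le, hz1⟩).resolve_left fun h =>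
          notMem_of_lt_csInf hzmem.2 hbelow ⟨⟨hz0, hz1⟩, h⟩)
      rw [hsq, sq, mul_self_div_self, div_eq_iff ht0.ne'] at hdiv
      exact hdiv
    · obtain ⟨s, hs, hst⟩ := (csInf_lt_iff hbelow hne).1 (not_le.1 hta)
      exact hδ.eq_sq_of_le hs.1.1 hst.le ht.2 hs.2
end

section
/- For every lower semilinear diagonal δ ∈ 𝒟^LSL, Chatterjee's rank correlation of the associated lower semilinear copula S_δ, given by ξ(S_δ) = 6·∫₀¹ ∫₀¹ (∂₁S_δ(s,t))² ds dt − 2 where ∂₁ denotes the (almost-everywhere existing) partial derivative of S_δ with respect to its first argument, satisfies ξ(S_δ) = τ(δ) − 2·∫₀¹ (t·δ′(t) − δ(t))·(2·δ(t) − t·δ′(t))/t dt, where δ′ denotes the a.e. derivative of δ. -/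
open MeasureTheory Set

/-- The lower semilinear copula with diagonal `δ`. -/
noncomputable def Scop (δ : ℝ → ℝ) (u v : ℝ) : ℝ :=
  if v ≤ u then v * δ u / u else u * δ v / v

theorem deriv_Scop_of_lt (δ : ℝ → ℝ) {s t : ℝ} (hst : s < t) :
    deriv (fun x => Scop δ x t) s = δ t / t := by
  have h : (fun x => Scop δ x t) =ᶠ[nhds s] fun x => x * (δ t / t) := by
    filter_upwards [Iio_mem_nhds hst] with x hx
    rw [Scop, if_neg (not_le.2 hx), mul_div_assoc]
  rw [h.deriv_eq, deriv_mul_const_field, deriv_id'', one_mul]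

theorem deriv_Scop_of_gt (δ : ℝ → ℝ) {s t : ℝ} (ht : 0 < t) (hts : t < s)
    (hd : DifferentiableAt ℝ δ s) :
    deriv (fun x => Scop δ x t) s = t * ((s * deriv δ s - δ s) / s ^ 2) := by
  have h : (fun x => Scop δ x t) =ᶠ[nhds s] fun x => t * (δ x / x) := by
    filter_upwards [Ioi_mem_nhds hts] with x hx
    rw [Scop, if_pos (le_of_lt hx), mul_div_assoc]
  rw [h.deriv_eq]
  have hq := (hd.hasDerivAt.div (hasDerivAt_id s) (ht.trans hts).ne').const_mul t
  refine HasDerivAt.deriv (hq.congr_deriv ?_)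
  simp only [id]
  ring

theorem intervalIntegral_zero_one_eq (f : ℝ → ℝ) :
    ∫ t in (0:ℝ)..1, f t = ∫ t in Ioo (0:ℝ) 1, f t := by
  rw [intervalIntegral.integral_of_le zero_le_one, integral_Ioc_eq_integral_Ioo]

theorem setIntegral_Ioo_ite_lt_left {t : ℝ} (ht : t ∈ Ioo (0:ℝ) 1) (f : ℝ → ℝ) :
    ∫ s in Ioo (0:ℝ) 1, (if s < t then f s else 0) = ∫ s in (0:ℝ)..t, f s := by
  have h : (fun s => if s < t then f s else 0) = (Iio t).indicator f := by
    ext s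
    simp [indicator_apply]
  rw [h, setIntegral_indicator measurableSet_Iio, Ioo_inter_Iio, min_eq_right ht.2.le,
    intervalIntegral.integral_of_le ht.1.le, integral_Ioc_eq_integral_Ioo]

/-- Quotients `f t * g t / t` of functions of linear growth at the origin are integrable. -/
theorem integrableOn_mul_div_of_abs_le {f g : ℝ → ℝ} {a b : ℝ}
    (hf : AEStronglyMeasurable f (volume.restrict (Ioo (0:ℝ) 1)))
    (hg : AEStronglyMeasurable g (volume.restrict (Ioo (0:ℝ) 1)))
    (hfa : ∀ t ∈ Ioo (0:ℝ) 1, |f t| ≤ a * t) (hgb : ∀ t ∈ Ioo (0:ℝ) 1, |g t| ≤ b * t) :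
    IntegrableOn (fun t => f t * g t / t) (Ioo (0:ℝ) 1) := by
  refine Integrable.of_bound
    ((hf.mul hg).mul measurable_inv.aestronglyMeasurable) (a * b) ?_
  filter_upwards [ae_restrict_mem measurableSet_Ioo] with t ht
  have hfa' := hfa t ht
  have hgb' := hgb t ht
  have h0 := ht.1
  have ha : 0 ≤ a := nonneg_of_mul_nonneg_left ((abs_nonneg _).trans hfa') h0
  have hb : 0 ≤ b := nonneg_of_mul_nonneg_left ((abs_nonneg _).trans hgb') h0
  rw [Real.norm_eq_abs, abs_div, abs_mul, abs_of_pos h0, div_le_iff₀ h0]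
  calc |f t| * |g t| ≤ (a * t) * (b * t) := by gcongr
    _ = a * b * t * t := by ring
    _ ≤ a * b * t * 1 := by
      gcongr
      exact ht.2.le
    _ = a * b * t := mul_one _

namespace IsLSL

variable {δ : ℝ → ℝ}

theorem lipschitzOnWith (hδ : IsLSL δ) : LipschitzOnWith 2 δ (Icc 0 1) := hδ.2.1

theorem absolutelyContinuousOnInterval (hδ : IsLSL δ) :
    AbsolutelyContinuousOnInterval δ 0 1 := by
  have h := hδ.lipschitzOnWith
  rw [← uIcc_of_le zero_le_one] at h
  exact h.absolutelyContinuousOnInterval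

theorem ae_differentiableAt (hδ : IsLSL δ) :
    ∀ᵐ t ∂volume.restrict (Ioo (0:ℝ) 1), DifferentiableAt ℝ δ t := by
  rw [ae_restrict_iff' measurableSet_Ioo]
  filter_upwards [hδ.absolutelyContinuousOnInterval.ae_differentiableAt] with t h ht
  exact h (by rw [uIcc_of_le zero_le_one]; exact Ioo_subset_Icc_self ht)

theorem abs_apply_le (hδ : IsLSL δ) {t : ℝ} (ht : t ∈ Ioo (0:ℝ) 1) : |δ t| ≤ t := by
  have h := hδ.2.2.2.1 t (Ioo_subset_Icc_self ht)
  rw [abs_of_nonneg ((sq_nonneg t).trans h.1)]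
  exact h.2

theorem abs_mul_deriv_sub_le (hδ : IsLSL δ) {t : ℝ} (ht : t ∈ Ioo (0:ℝ) 1) :
    |t * deriv δ t - δ t| ≤ 3 * t := by
  have h : |deriv δ t| ≤ 2 :=
    norm_deriv_le_of_lipschitzOn (Icc_mem_nhds ht.1 ht.2) hδ.lipschitzOnWith
  have h' := hδ.abs_apply_le ht
  calc |t * deriv δ t - δ t| ≤ |t * deriv δ t| + |δ t| := abs_sub _ _
    _ ≤ t * 2 + t := by
      rw [abs_mul, abs_of_pos ht.1]
      gcongr
      exact ht.1.le
    _ = 3 * t := by ring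

theorem aestronglyMeasurable (hδ : IsLSL δ) :
    AEStronglyMeasurable δ (volume.restrict (Ioo (0:ℝ) 1)) :=
  (hδ.lipschitzOnWith.continuousOn.mono Ioo_subset_Icc_self).aestronglyMeasurable
    measurableSet_Ioo

theorem aestronglyMeasurable_mul_deriv_sub (hδ : IsLSL δ) :
    AEStronglyMeasurable (fun t => t * deriv δ t - δ t) (volume.restrict (Ioo (0:ℝ) 1)) :=
  (measurable_id.mul (measurable_deriv δ)).aestronglyMeasurable.sub hδ.aestronglyMeasurable

theorem integrableOn_sq_div (hδ : IsLSL δ) :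
    IntegrableOn (fun t => δ t ^ 2 / t) (Ioo (0:ℝ) 1) := by
  simpa only [sq] using integrableOn_mul_div_of_abs_le (a := 1) (b := 1)
    hδ.aestronglyMeasurable hδ.aestronglyMeasurable
    (fun t ht => by simpa using hδ.abs_apply_le ht) (fun t ht => by simpa using hδ.abs_apply_le ht)

theorem integrableOn_mul_deriv_sub_mul_div (hδ : IsLSL δ) :
    IntegrableOn (fun t => (t * deriv δ t - δ t) * δ t / t) (Ioo (0:ℝ) 1) :=
  integrableOn_mul_div_of_abs_le (a := 3) (b := 1)
    hδ.aestronglyMeasurable_mul_deriv_sub hδ.aestronglyMeasurable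
    (fun _ ht => hδ.abs_mul_deriv_sub_le ht) (fun t ht => by simpa using hδ.abs_apply_le ht)

theorem integrableOn_mul_deriv_sub_sq_div (hδ : IsLSL δ) :
    IntegrableOn (fun t => (t * deriv δ t - δ t) ^ 2 / t) (Ioo (0:ℝ) 1) := by
  simpa only [sq] using integrableOn_mul_div_of_abs_le (a := 3) (b := 3)
    hδ.aestronglyMeasurable_mul_deriv_sub hδ.aestronglyMeasurable_mul_deriv_sub
    (fun _ ht => hδ.abs_mul_deriv_sub_le ht) (fun _ ht => hδ.abs_mul_deriv_sub_le ht)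

/-- Integration by parts: `2 ∫₀¹ (t δ′ - δ) δ / t = 1 - 2 ∫₀¹ δ² / t`. -/
theorem two_mul_integral_mul_deriv_sub_mul_div (hδ : IsLSL δ) :
    2 * ∫ t in Ioo (0:ℝ) 1, (t * deriv δ t - δ t) * δ t / t =
      1 - 2 * ∫ t in Ioo (0:ℝ) 1, δ t ^ 2 / t := by
  have hac := hδ.absolutelyContinuousOnInterval
  have h := hac.integral_deriv_mul_eq_sub hac
  rw [hδ.map_zero, hδ.2.2.1, intervalIntegral_zero_one_eq] at h
  have h' : ∫ t in Ioo (0:ℝ) 1, (deriv δ t * δ t + δ t * deriv δ t) =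
      ∫ t in Ioo (0:ℝ) 1,
        (2 * ((t * deriv δ t - δ t) * δ t / t) + 2 * (δ t ^ 2 / t)) := by
    refine setIntegral_congr_fun measurableSet_Ioo fun t ht => ?_
    have h0 := ht.1.ne'
    field_simp
    ring
  rw [h', integral_add (hδ.integrableOn_mul_deriv_sub_mul_div.const_mul 2)
    (hδ.integrableOn_sq_div.const_mul 2), integral_const_mul, integral_const_mul] at h
  linarith

/-- The squared partial derivative of `S_δ` above the diagonal, extended by zero. -/
noncomputable def upperKernel (δ : ℝ → ℝ) (t s : ℝ) : ℝ :=
  if t < s then t ^ 2 * ((s * deriv δ s - δ s) / s ^ 2) ^ 2 else 0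

theorem integrable_upperKernel (hδ : IsLSL δ) :
    Integrable (Function.uncurry (upperKernel δ))
      ((volume.restrict (Ioo (0:ℝ) 1)).prod (volume.restrict (Ioo (0:ℝ) 1))) := by
  have hq : AEStronglyMeasurable (fun s => ((s * deriv δ s - δ s) / s ^ 2) ^ 2)
      (volume.restrict (Ioo (0:ℝ) 1)) :=
    (hδ.aestronglyMeasurable_mul_deriv_sub.mul
      (measurable_id.pow_const 2).inv.aestronglyMeasurable).pow 2
  have hm : AEStronglyMeasurable
      ({p : ℝ × ℝ | p.1 < p.2}.indicator
        fun p => p.1 ^ 2 * ((p.2 * deriv δ p.2 - δ p.2) / p.2 ^ 2) ^ 2)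
      ((volume.restrict (Ioo (0:ℝ) 1)).prod (volume.restrict (Ioo (0:ℝ) 1))) :=
    ((measurable_fst.pow_const 2).aestronglyMeasurable.mul hq.comp_snd).indicator
      (measurableSet_lt measurable_fst measurable_snd)
  have hK : Function.uncurry (upperKernel δ) = {p : ℝ × ℝ | p.1 < p.2}.indicator
        fun p => p.1 ^ 2 * ((p.2 * deriv δ p.2 - δ p.2) / p.2 ^ 2) ^ 2 := by
    ext p
    simp [Function.uncurry, upperKernel, indicator_apply]
  rw [hK]
  refine Integrable.of_bound hm 9 ?_
  rw [Measure.prod_restrict]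
  filter_upwards [ae_restrict_mem (measurableSet_Ioo.prod measurableSet_Ioo)] with p hp
  obtain ⟨hp1, hp2⟩ := hp
  rw [indicator_apply]
  split_ifs with hlt
  · have hlt' : p.1 < p.2 := hlt
    have h0 := hp1.1
    have h2 := hp2.1
    have hA := sq_le_sq' (abs_le.1 (hδ.abs_mul_deriv_sub_le hp2)).1
      (abs_le.1 (hδ.abs_mul_deriv_sub_le hp2)).2
    rw [Real.norm_of_nonneg (by positivity), div_pow, ← mul_div_assoc,
      div_le_iff₀ (by positivity)]
    calc p.1 ^ 2 * (p.2 * deriv δ p.2 - δ p.2) ^ 2 ≤ p.2 ^ 2 * (3 * p.2) ^ 2 := by gcongr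
      _ = 9 * (p.2 ^ 2) ^ 2 := by ring
  · simp

theorem integral_upperKernel (δ : ℝ → ℝ) {s : ℝ} (hs : s ∈ Ioo (0:ℝ) 1) :
    ∫ t in Ioo (0:ℝ) 1, upperKernel δ t s = (s * deriv δ s - δ s) ^ 2 / s / 3 := by
  simp only [upperKernel]
  rw [setIntegral_Ioo_ite_lt_left hs, intervalIntegral.integral_mul_const, integral_pow]
  have h0 := hs.1.ne'
  field_simp
  norm_num
  ring

theorem integral_deriv_Scop_sq (hδ : IsLSL δ) {t : ℝ} (ht : t ∈ Ioo (0:ℝ) 1)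
    (hK : Integrable (upperKernel δ t) (volume.restrict (Ioo (0:ℝ) 1))) :
    ∫ s in Ioo (0:ℝ) 1, (deriv (fun x => Scop δ x t) s) ^ 2 =
      δ t ^ 2 / t + ∫ s in Ioo (0:ℝ) 1, upperKernel δ t s := by
  have hne : ∀ᵐ s ∂volume.restrict (Ioo (0:ℝ) 1), s ≠ t :=
    ae_restrict_of_ae (Measure.ae_ne volume t)
  have h : ∫ s in Ioo (0:ℝ) 1, (deriv (fun x => Scop δ x t) s) ^ 2 =
      ∫ s in Ioo (0:ℝ) 1, ((if s < t then (δ t / t) ^ 2 else 0) + upperKernel δ t s) := by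
    refine integral_congr_ae ?_
    filter_upwards [hδ.ae_differentiableAt, hne] with s hd hst
    rcases hst.lt_or_gt with hlt | hlt
    · rw [deriv_Scop_of_lt δ hlt, upperKernel, if_pos hlt, if_neg hlt.not_gt, add_zero]
    · rw [deriv_Scop_of_gt δ ht.1 hlt hd, upperKernel, if_neg hlt.not_gt, if_pos hlt,
        zero_add, mul_pow]
  have hi : Integrable (fun s => if s < t then (δ t / t) ^ 2 else 0)
      (volume.restrict (Ioo (0:ℝ) 1)) :=
    Integrable.of_bound
      (Measurable.ite measurableSet_Iio measurable_const
        measurable_const).aestronglyMeasurable ((δ t / t) ^ 2)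
      (ae_of_all _ fun s => by
        split_ifs
        · exact (Real.norm_of_nonneg (sq_nonneg _)).le
        · simpa using sq_nonneg (δ t / t))
  rw [h, integral_add hi hK, setIntegral_Ioo_ite_lt_left ht, intervalIntegral.integral_const]
  have h0 := ht.1.ne'
  congr 1
  rw [smul_eq_mul]
  field_simp
  ring

theorem integral_integral_deriv_Scop_sq (hδ : IsLSL δ) :
    ∫ t in Ioo (0:ℝ) 1, ∫ s in Ioo (0:ℝ) 1, (deriv (fun x => Scop δ x t) s) ^ 2 =
      (∫ t in Ioo (0:ℝ) 1, δ t ^ 2 / t) +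
        (∫ t in Ioo (0:ℝ) 1, (t * deriv δ t - δ t) ^ 2 / t) / 3 := by
  have hK := hδ.integrable_upperKernel
  have h : ∫ t in Ioo (0:ℝ) 1, ∫ s in Ioo (0:ℝ) 1, (deriv (fun x => Scop δ x t) s) ^ 2 =
      ∫ t in Ioo (0:ℝ) 1, (δ t ^ 2 / t + ∫ s in Ioo (0:ℝ) 1, upperKernel δ t s) := by
    refine integral_congr_ae ?_
    filter_upwards [hK.prod_right_ae, ae_restrict_mem measurableSet_Ioo] with t hKt ht
    exact hδ.integral_deriv_Scop_sq ht hKt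
  have hi : Integrable (fun t => ∫ s in Ioo (0:ℝ) 1, upperKernel δ t s)
      (volume.restrict (Ioo (0:ℝ) 1)) := hK.integral_prod_left
  rw [h, integral_add hδ.integrableOn_sq_div hi,
    integral_integral_swap hK,
    setIntegral_congr_fun measurableSet_Ioo fun s hs => integral_upperKernel δ hs,
    integral_div]

end IsLSL

/-- Chatterjee's rank correlation
`ξ(S_δ) = 6 ∫₀¹ ∫₀¹ (∂₁ S_δ(s,t))² ds dt − 2` satisfies
`ξ(S_δ) = τ(δ) − 2 ∫₀¹ (t δ′(t) − δ t)(2 δ t − t δ′(t))/t dt`. -/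
theorem xi_eq_tau_sub (δ : ℝ → ℝ) (hδ : IsLSL δ) :
    6 * (∫ t in (0:ℝ)..1, ∫ s in (0:ℝ)..1,
        (deriv (fun x => Scop δ x t) s) ^ 2) - 2 =
    tauLSL δ - 2 * ∫ t in (0:ℝ)..1,
      (t * deriv δ t - δ t) * (2 * δ t - t * deriv δ t) / t := by
  have hB : ∫ t in Ioo (0:ℝ) 1, (t * deriv δ t - δ t) * (2 * δ t - t * deriv δ t) / t =
      (∫ t in Ioo (0:ℝ) 1, (t * deriv δ t - δ t) * δ t / t) -
        ∫ t in Ioo (0:ℝ) 1, (t * deriv δ t - δ t) ^ 2 / t := by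
    rw [← integral_sub hδ.integrableOn_mul_deriv_sub_mul_div
      hδ.integrableOn_mul_deriv_sub_sq_div]
    refine integral_congr_ae (ae_of_all _ fun t => ?_)
    ring
  simp only [tauLSL, intervalIntegral_zero_one_eq]
  rw [hδ.integral_integral_deriv_Scop_sq, hB]
  linarith [hδ.two_mul_integral_mul_deriv_sub_mul_div]
end

section
/- For every p ∈ [1,2], the power diagonal δ_p(t) = t^p belongs to 𝒟^LSL and attains the lower bound of the τ-ξ region: ξ(δ_p) = 2·τ(δ_p)² / (1 + τ(δ_p)), with τ(δ_p) = (2−p)/p and ξ(δ_p) = (2−p)²/p. -/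
open MeasureTheory Set

/-- The integral of `t^(2p) / t` over `[0,1]`. -/
lemma integral_rpow_sq_div_self {p : ℝ} (hp : 0 < p) :
    ∫ t in (0:ℝ)..1, (t ^ p) ^ 2 / t = 1 / (2 * p) := by
  have h : ∫ t in (0:ℝ)..1, (t ^ p) ^ 2 / t = ∫ t in (0:ℝ)..1, t ^ (2 * p - 1) := by
    refine intervalIntegral.integral_congr_uIoo fun t ht => ?_
    rw [uIoo_of_le zero_le_one] at ht
    rw [Real.rpow_sub_one ht.1.ne', mul_comm, Real.rpow_mul ht.1.le, Real.rpow_two]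
  rw [h, integral_rpow (Or.inl (by linarith)), sub_add_cancel, Real.one_rpow,
    Real.zero_rpow (by linarith), sub_zero]

lemma tauLSL_rpow {p : ℝ} (hp : 0 < p) : tauLSL (fun t => t ^ p) = (2 - p) / p := by
  rw [tauLSL, integral_rpow_sq_div_self hp]
  field_simp
  ring

lemma xiLSL_rpow {p : ℝ} (hp : 0 < p) : xiLSL (fun t => t ^ p) = (2 - p) ^ 2 / p := by
  have h : ∫ t in (0:ℝ)..1, (t * deriv (fun s : ℝ => s ^ p) t - t ^ p) *
        (2 * t ^ p - t * deriv (fun s : ℝ => s ^ p) t) / t =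
      ∫ t in (0:ℝ)..1, (p - 1) * (2 - p) * ((t ^ p) ^ 2 / t) := by
    refine intervalIntegral.integral_congr_uIoo fun t ht => ?_
    rw [uIoo_of_le zero_le_one] at ht
    have hd : t * deriv (fun s : ℝ => s ^ p) t = p * t ^ p := by
      rw [(Real.hasDerivAt_rpow_const (Or.inl ht.1.ne')).deriv, Real.rpow_sub_one ht.1.ne']
      field_simp [ht.1.ne']
    simp only [hd]
    ring
  rw [xiLSL, h, intervalIntegral.integral_const_mul, integral_rpow_sq_div_self hp,
    tauLSL_rpow hp]
  field_simp
  ring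

lemma lipschitzOnWith_rpow_Icc {p : ℝ} (hp : p ∈ Icc (1:ℝ) 2) :
    LipschitzOnWith 2 (fun t : ℝ => t ^ p) (Icc 0 1) := by
  refine (convex_Icc (0:ℝ) 1).lipschitzOnWith_of_nnnorm_hasDerivWithin_le
    (fun t _ => (Real.hasDerivAt_rpow_const (Or.inr hp.1)).hasDerivWithinAt) fun t ht => ?_
  have h0 : 0 ≤ t ^ (p - 1) := Real.rpow_nonneg ht.1 _
  have h1 : t ^ (p - 1) ≤ 1 := Real.rpow_le_one ht.1 ht.2 (sub_nonneg.2 hp.1)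
  rw [← NNReal.coe_le_coe, coe_nnnorm, Real.norm_of_nonneg (mul_nonneg (by linarith [hp.1]) h0)]
  push_cast
  nlinarith [hp.1, hp.2]

lemma isLSL_rpow {p : ℝ} (hp : p ∈ Icc (1:ℝ) 2) : IsLSL (fun t => t ^ p) := by
  have hp0 : 0 < p := by linarith [hp.1]
  refine ⟨fun s hs t _ hst => Real.rpow_le_rpow hs.1 hst hp0.le, lipschitzOnWith_rpow_Icc hp,
    Real.one_rpow p, fun t ht => ?_, fun s hs t ht hst => ?_, fun s hs t ht hst => ?_⟩
  · rcases ht.1.eq_or_lt with rfl | h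
    · simp [Real.zero_rpow hp0.ne']
    · refine ⟨?_, ?_⟩
      · rw [← Real.rpow_two]
        exact Real.rpow_le_rpow_of_exponent_ge h ht.2 hp.2
      · simpa using Real.rpow_le_rpow_of_exponent_ge h ht.2 hp.1
  · change s ^ p / s ≤ t ^ p / t
    rw [← Real.rpow_sub_one hs.1.ne', ← Real.rpow_sub_one ht.1.ne']
    exact Real.rpow_le_rpow hs.1.le hst (sub_nonneg.2 hp.1)
  · change t ^ p / t ^ 2 ≤ s ^ p / s ^ 2
    rw [← Real.rpow_two, ← Real.rpow_two, ← Real.rpow_sub hs.1, ← Real.rpow_sub ht.1]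
    exact Real.rpow_le_rpow_of_nonpos hs.1 hst (sub_nonpos.2 hp.2)

/-- For every `p ∈ [1,2]`, the power diagonal `δ_p(t) = t^p` is lower semilinear and
attains the lower bound of the τ-ξ region, with `τ(δ_p) = (2−p)/p` and
`ξ(δ_p) = (2−p)²/p`. -/
theorem power_diagonal_attains_lower_bound (p : ℝ) (hp : p ∈ Icc (1:ℝ) 2) :
    IsLSL (fun t => t ^ p) ∧
    tauLSL (fun t => t ^ p) = (2 - p) / p ∧
    xiLSL (fun t => t ^ p) = (2 - p) ^ 2 / p ∧
    xiLSL (fun t => t ^ p) =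
      2 * (tauLSL (fun t => t ^ p)) ^ 2 / (1 + tauLSL (fun t => t ^ p)) := by
  have hp0 : 0 < p := by linarith [hp.1]
  refine ⟨isLSL_rpow hp, tauLSL_rpow hp0, xiLSL_rpow hp0, ?_⟩
  rw [xiLSL_rpow hp0, tauLSL_rpow hp0]
  have h : 1 + (2 - p) / p = 2 / p := by
    field_simp
    ring
  rw [h]
  field_simp
end

section
/- For a lower semilinear diagonal δ ∈ 𝒟^LSL, the identity ξ(δ) = τ(δ) holds if and only if, for Lebesgue-almost every t ∈ [0,1], either t·δ′(t) = δ(t) or t·δ′(t) = 2·δ(t). -/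
open MeasureTheory Set

lemma IsLSL.mul_deriv_bounds {δ : ℝ → ℝ} (hδ : IsLSL δ) {t : ℝ} (ht : t ∈ Ioo (0:ℝ) 1)
    (hd : DifferentiableAt ℝ δ t) : δ t ≤ t * deriv δ t ∧ t * deriv δ t ≤ 2 * δ t := by
  obtain ⟨-, -, -, -, hmono, hanti⟩ := hδ
  have ht0 : 0 < t := ht.1
  have hnhds : Ioc (0:ℝ) 1 ∈ nhds t := Ioc_mem_nhds ht.1 ht.2
  have hdiv := hd.hasDerivAt.fun_div (hasDerivAt_id' t) ht0.ne'
  have hdiv_sq := hd.hasDerivAt.fun_div (hasDerivAt_pow 2 t) (pow_pos ht0 2).ne'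
  have h₁ := hmono.derivWithin_nonneg (x := t)
  have h₂ := hanti.derivWithin_nonpos (x := t)
  rw [derivWithin_of_mem_nhds hnhds, hdiv.deriv, le_div_iff₀ (by positivity)] at h₁
  rw [derivWithin_of_mem_nhds hnhds, hdiv_sq.deriv, div_le_iff₀ (by positivity)] at h₂
  norm_num at h₁ h₂
  constructor
  · linarith
  · refine le_of_mul_le_mul_left ?_ ht0
    nlinarith

lemma IsLSL.ae_mul_deriv_bounds {δ : ℝ → ℝ} (hδ : IsLSL δ) :
    ∀ᵐ t ∂(volume.restrict (Ioo (0:ℝ) 1)),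
      δ t ≤ t * deriv δ t ∧ t * deriv δ t ≤ 2 * δ t := by
  have hdiff := (hδ.2.1.mono Ioo_subset_Icc_self).ae_differentiableWithinAt_real
    (measurableSet_Ioo (a := (0:ℝ)) (b := 1))
  filter_upwards [hdiff, ae_restrict_mem measurableSet_Ioo] with t hd ht
  exact hδ.mul_deriv_bounds ht (hd.differentiableAt (Ioo_mem_nhds ht.1 ht.2))

lemma IsLSL.integrableOn_xi_integrand {δ : ℝ → ℝ} (hδ : IsLSL δ) :
    IntegrableOn (fun t => (t * deriv δ t - δ t) * (2 * δ t - t * deriv δ t) / t)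
      (Ioo (0:ℝ) 1) := by
  have hδm : AEMeasurable δ (volume.restrict (Ioo (0:ℝ) 1)) :=
    (hδ.2.1.continuousOn.mono Ioo_subset_Icc_self).aemeasurable measurableSet_Ioo
  have hdm : AEMeasurable (deriv δ) (volume.restrict (Ioo (0:ℝ) 1)) :=
    (measurable_deriv δ).aemeasurable
  refine Integrable.of_bound (C := 1) ?_ ?_
  · exact AEMeasurable.aestronglyMeasurable (by fun_prop)
  filter_upwards [hδ.ae_mul_deriv_bounds, ae_restrict_mem measurableSet_Ioo] with t hb ht
  have hle := (hδ.2.2.2.1 t (Ioo_subset_Icc_self ht)).2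
  obtain ⟨ht0, ht1⟩ := ht
  have h₁ : 0 ≤ t * deriv δ t - δ t := by linarith
  have h₂ : 0 ≤ 2 * δ t - t * deriv δ t := by linarith
  rw [Real.norm_of_nonneg (by positivity), div_le_one ht0]
  calc (t * deriv δ t - δ t) * (2 * δ t - t * deriv δ t) ≤ t * 1 := by
        gcongr <;> linarith
    _ = t := mul_one t

/-- `ξ(δ) = τ(δ)` holds iff for a.e. `t ∈ [0,1]` either `t δ′(t) = δ t` or `t δ′(t) = 2 δ t`. -/
theorem xi_eq_tau_iff (δ : ℝ → ℝ) (hδ : IsLSL δ) :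
    xiLSL δ = tauLSL δ ↔
    (∀ᵐ t ∂(volume.restrict (Icc (0:ℝ) 1)),
      t * deriv δ t = δ t ∨ t * deriv δ t = 2 * δ t) := by
  have hnonneg : 0 ≤ᵐ[volume.restrict (Ioo (0:ℝ) 1)]
      fun t => (t * deriv δ t - δ t) * (2 * δ t - t * deriv δ t) / t := by
    filter_upwards [hδ.ae_mul_deriv_bounds, ae_restrict_mem measurableSet_Ioo] with t hb ht
    exact div_nonneg (mul_nonneg (by linarith) (by linarith)) ht.1.le
  have hxi : xiLSL δ = tauLSL δ ↔ ∫ t in Ioo (0:ℝ) 1,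
      (t * deriv δ t - δ t) * (2 * δ t - t * deriv δ t) / t = 0 := by
    rw [xiLSL, intervalIntegral.integral_of_le zero_le_one, integral_Ioc_eq_integral_Ioo]
    constructor <;> intro h <;> linarith
  rw [hxi, integral_eq_zero_iff_of_nonneg_ae hnonneg hδ.integrableOn_xi_integrand,
    ← restrict_Ioo_eq_restrict_Icc]
  refine Filter.eventually_congr ?_
  filter_upwards [ae_restrict_mem measurableSet_Ioo] with t ht
  simp only [Pi.zero_apply, div_eq_zero_iff, mul_eq_zero, ht.1.ne', or_false, sub_eq_zero]
  rw [eq_comm (a := 2 * δ t)]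
end
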